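/- arXiv:1104.2463 — 5 statements merged into one kernel-verified Lean document; each statement's English description precedes it below -/
import Mathlib

section
/- Let A be a sequence algebra and X an essential homogeneous normed A-module with completion X̄. Then for every x ∈ X̄ (in particular for every x ∈ X) there exist an element x̄ ∈ X̄ and real numbers λₙ ≥ 1 with λₙ → ∞ such that pⁿ·x̄ = λₙ (pⁿ·x) for every n. -/
noncomputable section

open Filter Topology

/-- A coisometric (quotient) bounded operator between complex normed spaces. -/
def IsCoisometry {Y X : Type} [NormedAddCommGroup Y] [NormedSpace ℂ Y]
    [NormedAddCommGroup X] [NormedSpace ℂ X] (τ : Y →L[ℂ] X) : Prop :=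
  (∀ y : Y, ‖τ y‖ ≤ ‖y‖) ∧ ∀ x : X, ∀ ε : ℝ, 0 < ε → ∃ y : Y, τ y = x ∧ ‖y‖ < ‖x‖ + ε

/-- Extreme (metric) projectivity in the category Nor of all complex normed spaces. -/
def ExtremelyProjectiveNor (P : Type) [NormedAddCommGroup P] [NormedSpace ℂ P] : Prop :=
  ∀ (Y X : Type) [NormedAddCommGroup Y] [NormedSpace ℂ Y]
    [NormedAddCommGroup X] [NormedSpace ℂ X],
    ∀ τ : Y →L[ℂ] X, IsCoisometry τ →
      ∀ φ : P →L[ℂ] X, ∀ ε : ℝ, 0 < ε →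
        ∃ ψ : P →L[ℂ] Y, τ.comp ψ = φ ∧ ‖ψ‖ < ‖φ‖ + ε

/-- Topological projectivity in Nor. -/
def TopologicallyProjectiveNor (P : Type) [NormedAddCommGroup P] [NormedSpace ℂ P] : Prop :=
  ∀ (Y X : Type) [NormedAddCommGroup Y] [NormedSpace ℂ Y]
    [NormedAddCommGroup X] [NormedSpace ℂ X],
    ∀ τ : Y →L[ℂ] X, IsCoisometry τ →
      ∀ φ : P →L[ℂ] X, ∃ ψ : P →L[ℂ] Y, τ.comp ψ = φ

/-- A (contractive, non-degenerate in no way assumed) normed left module over a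
(not necessarily unital) complex normed algebra `A`. -/
structure NormedMod (A : Type) [NonUnitalNormedRing A] [NormedSpace ℂ A] : Type 1 where
  X : Type
  [grp : NormedAddCommGroup X]
  [sp : NormedSpace ℂ X]
  smul : A → X → X
  smul_add : ∀ (a : A) (x y : X), smul a (x + y) = smul a x + smul a y
  add_smul : ∀ (a b : A) (x : X), smul (a + b) x = smul a x + smul b x
  smul_csmul : ∀ (c : ℂ) (a : A) (x : X), smul a (c • x) = c • smul a x
  csmul_smul : ∀ (c : ℂ) (a : A) (x : X), smul (c • a) x = c • smul a x
  mul_smul : ∀ (a b : A) (x : X), smul (a * b) x = smul a (smul b x)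
  norm_smul_le : ∀ (a : A) (x : X), ‖smul a x‖ ≤ ‖a‖ * ‖x‖

attribute [instance] NormedMod.grp NormedMod.sp

variable {A : Type} [NonUnitalNormedRing A] [NormedSpace ℂ A]
  [IsScalarTower ℂ A A] [SMulCommClass ℂ A A]

/-- Bounded `A`-module morphism property for a bounded operator between the underlying spaces. -/
def IsMor (M N : NormedMod A) (f : M.X →L[ℂ] N.X) : Prop :=
  ∀ (a : A) (x : M.X), f (M.smul a x) = N.smul a (f x)

/-- Extreme (metric) projectivity of a normed `A`-module with respect to a class `K`
of normed `A`-modules. -/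
def ExtremelyProjective (P : NormedMod A) (K : NormedMod A → Prop) : Prop :=
  ∀ (MY MX : NormedMod A), K MY → K MX →
    ∀ τ : MY.X →L[ℂ] MX.X, IsMor MY MX τ → IsCoisometry τ →
      ∀ φ : P.X →L[ℂ] MX.X, IsMor P MX φ → ∀ ε : ℝ, 0 < ε →
        ∃ ψ : P.X →L[ℂ] MY.X, IsMor P MY ψ ∧ τ.comp ψ = φ ∧ ‖ψ‖ < ‖φ‖ + ε

/-- Topological projectivity of a normed `A`-module with respect to a class `K`. -/
def TopologicallyProjective (P : NormedMod A) (K : NormedMod A → Prop) : Prop :=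
  ∀ (MY MX : NormedMod A), K MY → K MX →
    ∀ τ : MY.X →L[ℂ] MX.X, IsMor MY MX τ → IsCoisometry τ →
      ∀ φ : P.X →L[ℂ] MX.X, IsMor P MX φ →
        ∃ ψ : P.X →L[ℂ] MY.X, IsMor P MY ψ ∧ τ.comp ψ = φ

/-- A sequence algebra: a normed algebra `A` realized (injectively, by `coords`) as an
algebra of complex sequences with coordinatewise operations, containing the elements
`p n` (the sequences with a single entry `1` in position `n`, which span `c₀₀`) so that
`c₀₀` is dense and `‖p n‖ = 1`. -/
structure SequenceAlgebra (A : Type) [NonUnitalNormedRing A] [NormedSpace ℂ A] : Type where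
  coords : A →ₗ[ℂ] (ℕ → ℂ)
  coords_injective : Function.Injective coords
  coords_mul : ∀ a b : A, coords (a * b) = coords a * coords b
  p : ℕ → A
  coords_p : ∀ n : ℕ, coords (p n) = fun m => if m = n then (1 : ℂ) else 0
  norm_p : ∀ n : ℕ, ‖p n‖ = 1
  dense_c00 : Dense (↑(Submodule.span ℂ (Set.range p)) : Set A)

variable (SA : SequenceAlgebra A)

/-- The action of a fixed `a : A` as a `ℂ`-linear map on a normed `A`-module. -/
def NormedMod.smulLM (M : NormedMod A) (a : A) : M.X →ₗ[ℂ] M.X where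
  toFun := M.smul a
  map_add' := M.smul_add a
  map_smul' := fun c x => M.smul_csmul c a x

/-- The `n`-th coordinate subspace `Xₙ = {pⁿ · x : x ∈ X}` of a normed `A`-module. -/
def coordSub (M : NormedMod A) (n : ℕ) : Submodule ℂ M.X :=
  LinearMap.range (M.smulLM (SA.p n))

/-- A normed `A`-module is essential (non-degenerate) if the closed linear span of
`{a · x}` is everything. -/
def NormedMod.Essential (M : NormedMod A) : Prop :=
  Dense (↑(Submodule.span ℂ {y : M.X | ∃ (a : A) (x : M.X), y = M.smul a x}) : Set M.X)

/-- Homogeneity: the norm of an element is monotonely determined by the norms of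
its coordinates. -/
def Homogeneous (M : NormedMod A) : Prop :=
  ∀ x y : M.X, (∀ n : ℕ, ‖M.smul (SA.p n) x‖ ≤ ‖M.smul (SA.p n) y‖) → ‖x‖ ≤ ‖y‖

/-- An element is finite if its coordinates eventually vanish. -/
def FiniteElt (M : NormedMod A) (x : M.X) : Prop :=
  ∃ N : ℕ, ∀ n : ℕ, N ≤ n → M.smul (SA.p n) x = 0

/-- A module has finite type if all its elements are finite, i.e. `X = X₀₀`. -/
def FiniteType (M : NormedMod A) : Prop :=
  ∀ x : M.X, FiniteElt SA M x


/-- `N` is a completion of `M`: `N` is a Banach `A`-module in which `M` embeds by an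
isometric module morphism with dense range. -/
def IsCompletionOf (M N : NormedMod A) : Prop :=
  CompleteSpace N.X ∧
    ∃ ι : M.X →L[ℂ] N.X, IsMor M N ι ∧ (∀ x : M.X, ‖ι x‖ = ‖x‖) ∧ DenseRange ι

set_option linter.unusedSectionVars false

/-- The action of a normed module as a continuous bilinear map. -/
def NormedMod.action (M : NormedMod A) : A →L[ℂ] M.X →L[ℂ] M.X :=
  LinearMap.mkContinuous₂ (LinearMap.mk₂ ℂ M.smul M.add_smul M.csmul_smul M.smul_add M.smul_csmul) 1
    fun a x => by simpa using M.norm_smul_le a x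

theorem NormedMod.action_apply (M : NormedMod A) (a : A) (x : M.X) :
    M.action a x = M.smul a x := rfl

theorem NormedMod.action_mul (M : NormedMod A) (a b : A) (x : M.X) :
    M.action (a * b) x = M.action a (M.action b x) := M.mul_smul a b x

theorem SequenceAlgebra.p_mul_p (m n : ℕ) :
    SA.p m * SA.p n = if m = n then SA.p m else 0 := by
  apply SA.coords_injective
  rw [SA.coords_mul]
  ext i
  split_ifs with h
  · subst h
    simp [SA.coords_p]
  · simp only [SA.coords_p, map_zero, Pi.mul_apply, Pi.zero_apply]
    split_ifs <;> simp_all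

/-- The sequence with `1` in the first `k` positions and `0` elsewhere. -/
def SequenceAlgebra.initial (k : ℕ) : A := ∑ n ∈ Finset.range k, SA.p n

theorem SequenceAlgebra.p_mul_initial (n k : ℕ) :
    SA.p n * SA.initial k = if n < k then SA.p n else 0 := by
  simp [SequenceAlgebra.initial, Finset.mul_sum, SA.p_mul_p]

theorem SequenceAlgebra.initial_mul_p (k n : ℕ) :
    SA.initial k * SA.p n = if n < k then SA.p n else 0 := by
  simp [SequenceAlgebra.initial, Finset.sum_mul, SA.p_mul_p]

theorem Homogeneous.norm_initial_le {M : NormedMod A} (hhom : Homogeneous SA M) (k : ℕ) (x : M.X) :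
    ‖M.action (SA.initial k) x‖ ≤ ‖x‖ := by
  refine hhom _ _ fun n => ?_
  rw [← M.action_apply, ← M.action_apply, ← M.action_mul, SA.p_mul_initial]
  split_ifs <;> simp

theorem Homogeneous.norm_initial_le_of_isCompletionOf {M N : NormedMod A}
    (hhom : Homogeneous SA M) (hN : IsCompletionOf M N) (k : ℕ) (x : N.X) :
    ‖N.action (SA.initial k) x‖ ≤ ‖x‖ := by
  obtain ⟨-, ι, hmor, hiso, hdense⟩ := hN
  refine hdense.induction_on (p := fun x => ‖N.action (SA.initial k) x‖ ≤ ‖x‖) x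
    (isClosed_le (by fun_prop) (by fun_prop)) fun y => ?_
  rw [N.action_apply, ← hmor, hiso, hiso]
  exact hhom.norm_initial_le SA k y

/-- Uniformly contractive operators converge strongly to the identity on a closed subspace. -/
theorem isClosed_setOf_tendsto_self {E : Type*} [NormedAddCommGroup E] [NormedSpace ℂ E]
    {T : ℕ → E →L[ℂ] E} (hT : ∀ k x, ‖T k x‖ ≤ ‖x‖) :
    IsClosed {x : E | Tendsto (fun k => T k x) atTop (𝓝 x)} := by
  have hlip (k : ℕ) : LipschitzWith 1 (T k) :=
    AddMonoidHomClass.lipschitz_of_bound_nnnorm (T k) 1 fun x => by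
      simpa [← NNReal.coe_le_coe] using hT k x
  exact (LipschitzWith.uniformEquicontinuous (fun k => ⇑(T k)) 1 hlip).equicontinuous
    |>.isClosed_setOfPred_tendsto continuous_id

theorem tendsto_initial {M N : NormedMod A} (hess : M.Essential) (hhom : Homogeneous SA M)
    (hN : IsCompletionOf M N) (x : N.X) :
    Tendsto (fun k => N.action (SA.initial k) x) atTop (𝓝 x) := by
  let F : Submodule ℂ N.X :=
    { carrier := {x | Tendsto (fun k => N.action (SA.initial k) x) atTop (𝓝 x)}
      add_mem' := fun {x y} hx hy => by simpa using Tendsto.add hx hy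
      zero_mem' := by simp
      smul_mem' := fun c x hx => by simpa using Tendsto.const_smul hx c }
  have hF : IsClosed (F : Set N.X) :=
    isClosed_setOf_tendsto_self (hhom.norm_initial_le_of_isCompletionOf SA hN)
  obtain ⟨-, ι, hmor, -, hdense⟩ := hN
  have hp (n : ℕ) (y : N.X) : N.action (SA.p n) y ∈ F := by
    refine tendsto_const_nhds.congr' ?_
    filter_upwards [eventually_gt_atTop n] with k hk
    rw [← N.action_mul, SA.initial_mul_p, if_pos hk]
  have hA (a : A) (y : N.X) : N.action a y ∈ F := by
    refine SA.dense_c00.induction (P := fun a => N.action a y ∈ F) (fun b hb => ?_)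
      (hF.preimage (by fun_prop)) a
    induction hb using Submodule.span_induction with
    | mem b hb =>
      obtain ⟨n, rfl⟩ := hb
      exact hp n y
    | zero => simp
    | add b c _ _ hb hc => simpa using F.add_mem hb hc
    | smul c b _ hb => simpa using F.smul_mem c hb
  have hι (z : M.X) : ι z ∈ F := by
    refine hess.induction (P := fun z => ι z ∈ F) (fun w hw => ?_)
      (hF.preimage ι.continuous) z
    refine (Submodule.span_le (p := F.comap (ι : M.X →ₗ[ℂ] N.X))).2 ?_ hw
    rintro _ ⟨a, v, rfl⟩
    change ι (M.smul a v) ∈ F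
    rw [hmor]
    exact hA a (ι v)
  exact hdense.induction_on (p := fun x => x ∈ F) x hF hι

/-- The number of terms of `k` that are at most `n`, when `k` is strictly increasing. -/
def countLE (k : ℕ → ℕ) (n : ℕ) : ℕ := {j ∈ Finset.range (n + 1) | k j ≤ n}.card

theorem tendsto_countLE {k : ℕ → ℕ} (hk : StrictMono k) : Tendsto (countLE k) atTop atTop := by
  refine tendsto_atTop.2 fun b => ?_
  filter_upwards [eventually_ge_atTop (k b)] with n hn
  calc b = (Finset.range b).card := (Finset.card_range b).symm
    _ ≤ _ := Finset.card_le_card fun j hj => by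
      have hj := Finset.mem_range.1 hj
      have h₁ := hk hj
      have h₂ := hk.le_apply (x := j)
      simp only [Finset.mem_filter, Finset.mem_range]
      omega

theorem hasSum_ite_countLE {E : Type*} [NormedAddCommGroup E] [NormedSpace ℂ E] {k : ℕ → ℕ}
    (hk : StrictMono k) (n : ℕ) (x : E) :
    HasSum (fun j => if k j ≤ n then x else 0) ((countLE k n : ℂ) • x) := by
  have h : ∑ j ∈ Finset.range (n + 1), (if k j ≤ n then x else 0) = (countLE k n : ℂ) • x := by
    rw [← Finset.sum_filter, Finset.sum_const, Nat.cast_smul_eq_nsmul]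
    rfl
  rw [← h]
  refine hasSum_sum_of_ne_finset_zero fun j hj => if_neg fun hjn => hj ?_
  have := hk.le_apply (x := j)
  exact Finset.mem_range.2 (by omega)

/-- Proposition 1.7: for every element `x` of the completion `X̄` of an essential
homogeneous normed module `X` over a sequence algebra, there is `x̄ ∈ X̄` whose
coordinates are `λₙ xₙ` with real `λₙ ≥ 1`, `λₙ → ∞`. -/
theorem exists_slower_element
    (M : NormedMod A) (hess : M.Essential) (hhom : Homogeneous SA M)
    (N : NormedMod A) (hN : IsCompletionOf M N) (x : N.X) :
    ∃ (xbar : N.X) (lam : ℕ → ℝ),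
      (∀ n : ℕ, 1 ≤ lam n) ∧ Filter.Tendsto lam Filter.atTop Filter.atTop ∧
        ∀ n : ℕ, N.smul (SA.p n) xbar = (lam n : ℂ) • N.smul (SA.p n) x := by
  have : CompleteSpace N.X := hN.1
  have hlim := tendsto_initial SA hess hhom hN x
  obtain ⟨k, hk, hdist⟩ := extraction_forall_of_eventually fun j : ℕ =>
    Metric.tendsto_nhds.1 hlim ((1 / 2) ^ j) (by positivity)
  have hsum : Summable fun j => x - N.action (SA.initial (k j)) x := by
    refine Summable.of_norm_bounded summable_geometric_two fun j => ?_
    rw [← dist_eq_norm, dist_comm]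
    exact (hdist j).le
  refine ⟨x + ∑' j, (x - N.action (SA.initial (k j)) x), fun n => 1 + (countLE k n : ℝ),
    fun n => by simp, ?_, fun n => ?_⟩
  · exact tendsto_atTop_add_const_left _ _
      (tendsto_natCast_atTop_atTop.comp (tendsto_countLE hk))
  · have hterm (j : ℕ) : N.action (SA.p n) (x - N.action (SA.initial (k j)) x) =
        if k j ≤ n then N.action (SA.p n) x else 0 := by
      rw [map_sub, ← N.action_mul, SA.p_mul_initial]
      by_cases h : n < k j
      · simp [h, not_le.2 h]
      · simp [h, not_lt.1 h]
    rw [← N.action_apply, ← N.action_apply, map_add, (N.action (SA.p n)).map_tsum hsum]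
    simp only [hterm]
    rw [(hasSum_ite_countLE hk n _).tsum_eq]
    push_cast
    rw [add_smul, one_smul]

end
end

section
/- For every index set Λ, the normed space l₁⁰(Λ) is extremely projective in Nor. -/
noncomputable section

instance : Fact ((1 : ENNReal) ≤ 1) := ⟨le_rfl⟩

/-- The Banach space `l₁(Λ)` of absolutely summable complex functions on `Λ`. -/
abbrev l1Space (Λ : Type) : Type := lp (fun _ : Λ => ℂ) 1

/-- The canonical basis vector `e_ν` in `l₁(Λ)`. -/
def l1single (Λ : Type) (ν : Λ) : l1Space Λ :=
  letI : DecidableEq Λ := Classical.decEq Λ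
  lp.single 1 ν (1 : ℂ)

/-- The subspace `l₁⁰(Λ)` of finitely supported functions, i.e. the linear span
of the canonical basis vectors, with the `l₁`-norm. -/
def l10 (Λ : Type) : Submodule ℂ (l1Space Λ) :=
  Submodule.span ℂ (Set.range (l1single Λ))

/-- The canonical basis vector `e_ν` as an element of `l₁⁰(Λ)`. -/
def l10e (Λ : Type) (ν : Λ) : ↥(l10 Λ) :=
  ⟨l1single Λ ν, Submodule.subset_span ⟨ν, rfl⟩⟩

lemma l1single_apply (Λ : Type) [DecidableEq Λ] (ν i : Λ) :
    l1single Λ ν i = if i = ν then 1 else 0 := by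
  obtain rfl : ‹DecidableEq Λ› = Classical.decEq Λ := Subsingleton.elim _ _
  simp only [l1single, lp.coeFn_single, Pi.single_apply]

lemma l10_support_finite {Λ : Type} (f : l10 Λ) :
    (Function.support (f : l1Space Λ)).Finite := by
  classical
  obtain ⟨f, hf⟩ := f
  induction hf using Submodule.span_induction with
  | mem x hx =>
    obtain ⟨ν, rfl⟩ := hx
    refine (Set.finite_singleton ν).subset fun i hi => ?_
    by_contra h
    exact hi ((l1single_apply Λ ν i).trans (if_neg h))
  | zero => exact Set.finite_empty.subset fun _ hi => hi rfl
  | add x y _ _ hx hy => exact (hx.union hy).subset (Function.support_add _ _)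
  | smul a x _ hx => exact hx.subset (Function.support_const_smul_subset a _)

/-- The finitely supported coordinate function of an element of `l₁⁰(Λ)`. -/
def l10ToFinsupp (Λ : Type) : l10 Λ →ₗ[ℂ] Λ →₀ ℂ where
  toFun f := Finsupp.ofSupportFinite (f : l1Space Λ) (l10_support_finite f)
  map_add' _ _ := Finsupp.ext fun _ => rfl
  map_smul' _ _ := Finsupp.ext fun _ => rfl

lemma l10ToFinsupp_apply {Λ : Type} (f : l10 Λ) (i : Λ) :
    l10ToFinsupp Λ f i = (f : l1Space Λ) i := rfl

lemma l10ToFinsupp_l10e (Λ : Type) (ν : Λ) :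
    l10ToFinsupp Λ (l10e Λ ν) = Finsupp.single ν 1 := by
  classical
  ext i
  rw [l10ToFinsupp_apply, Finsupp.single_apply]
  simp only [l10e, l1single_apply, eq_comm]

lemma norm_l10e (Λ : Type) (ν : Λ) : ‖l10e Λ ν‖ = 1 := by
  let _ : DecidableEq Λ := Classical.decEq Λ
  exact (lp.norm_single (E := fun _ : Λ => ℂ) one_pos ν (1 : ℂ)).trans norm_one

lemma norm_l10_eq_sum {Λ : Type} (f : l10 Λ) :
    ‖f‖ = (l10ToFinsupp Λ f).sum fun _ a => ‖a‖ := by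
  have h := lp.norm_eq_tsum_rpow (p := 1) (by simp) (f : l1Space Λ)
  simp only [ENNReal.toReal_one, Real.rpow_one, div_one] at h
  rw [Submodule.coe_norm, h, Finsupp.sum, tsum_eq_sum (s := (l10ToFinsupp Λ f).support)]
  · rfl
  · intro i hi
    rw [Finsupp.notMem_support_iff, l10ToFinsupp_apply] at hi
    rw [hi, norm_zero]

lemma l10_linearMap_ext {Λ : Type} {X : Type*} [AddCommGroup X] [Module ℂ X]
    {S T : l10 Λ →ₗ[ℂ] X} (h : ∀ ν, S (l10e Λ ν) = T (l10e Λ ν)) : S = T := by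
  ext ⟨f, hf⟩
  induction hf using Submodule.span_induction with
  | mem x hx =>
    obtain ⟨ν, rfl⟩ := hx
    exact h ν
  | zero => exact (map_zero S).trans (map_zero T).symm
  | add x y hx hy ihx ihy =>
    exact (map_add S ⟨x, hx⟩ ⟨y, hy⟩).trans
      ((congrArg₂ (· + ·) ihx ihy).trans (map_add T ⟨x, hx⟩ ⟨y, hy⟩).symm)
  | smul a x hx ih =>
    exact (map_smul S a ⟨x, hx⟩).trans
      ((congrArg (a • ·) ih).trans (map_smul T a ⟨x, hx⟩).symm)

lemma norm_linearCombination_l10ToFinsupp_le {Λ : Type} {Y : Type*} [NormedAddCommGroup Y]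
    [NormedSpace ℂ Y] {y : Λ → Y} {C : ℝ} (hy : ∀ ν, ‖y ν‖ ≤ C) (f : l10 Λ) :
    ‖Finsupp.linearCombination ℂ y (l10ToFinsupp Λ f)‖ ≤ C * ‖f‖ := by
  rw [norm_l10_eq_sum, Finsupp.linearCombination_apply, Finsupp.sum, Finsupp.sum, Finset.mul_sum]
  refine norm_sum_le_of_le _ fun ν _ => ?_
  rw [norm_smul, mul_comm]
  exact mul_le_mul_of_nonneg_right (hy ν) (norm_nonneg _)

/-- For every index set `Λ`, the normed space `l₁⁰(Λ)` is extremely projective in Nor. -/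
theorem l10_extremelyProjectiveNor (Λ : Type) :
    ExtremelyProjectiveNor ↥(l10 Λ) := by
  intro Y X _ _ _ _ τ hτ φ ε hε
  have lift (ν : Λ) : ∃ y : Y, τ y = φ (l10e Λ ν) ∧ ‖y‖ ≤ ‖φ‖ + ε / 2 := by
    obtain ⟨y, hy, hlt⟩ := hτ.2 (φ (l10e Λ ν)) (ε / 2) (half_pos hε)
    have hφ := φ.le_opNorm (l10e Λ ν)
    rw [norm_l10e, mul_one] at hφ
    exact ⟨y, hy, by linarith⟩
  choose y hy hbound using lift
  refine ⟨(Finsupp.linearCombination ℂ y ∘ₗ l10ToFinsupp Λ).mkContinuous (‖φ‖ + ε / 2)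
    (norm_linearCombination_l10ToFinsupp_le hbound), ?_, ?_⟩
  · refine ContinuousLinearMap.coe_injective (l10_linearMap_ext fun ν => ?_)
    simp [l10ToFinsupp_l10e, hy]
  · refine (LinearMap.mkContinuous_norm_le _ (by positivity) _).trans_lt ?_
    linarith

end
end

section
/- If a normed space P is extremely projective in Nor, then P is isometrically isomorphic to a dense subspace of l₁(Λ) for some index set Λ. -/
noncomputable section

theorem l1Space_summable_norm {Λ : Type} (y : l1Space Λ) : Summable fun t => ‖y t‖ := by
  simpa using (lp.memℓp y).summable (by norm_num)

theorem l1Space_norm_eq_tsum {Λ : Type} (y : l1Space Λ) : ‖y‖ = ∑' t, ‖y t‖ := by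
  simpa using lp.norm_eq_tsum_rpow (p := 1) (by norm_num) y

theorem l1Space_sum_norm_le {Λ : Type} (y : l1Space Λ) (F : Finset Λ) :
    ∑ t ∈ F, ‖y t‖ ≤ ‖y‖ := by
  rw [l1Space_norm_eq_tsum]
  exact (l1Space_summable_norm y).sum_le_tsum F fun _ _ => norm_nonneg _

theorem l1Space_exists_finset {Λ : Type} (y : l1Space Λ) {η : ℝ} (hη : 0 < η) :
    ∃ F : Finset Λ, ‖y‖ - η < ∑ t ∈ F, ‖y t‖ := by
  have h : HasSum (fun t => ‖y t‖) ‖y‖ := by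
    rw [l1Space_norm_eq_tsum]; exact (l1Space_summable_norm y).hasSum
  exact (h.eventually (lt_mem_nhds (sub_lt_self _ hη))).exists

section Lift

variable {E : Type} [NormedAddCommGroup E] [NormedSpace ℂ E] [CompleteSpace E]

theorem l1Space_summable_smul {Λ : Type} {v : Λ → E} (hv : ∀ t, ‖v t‖ ≤ 1) (y : l1Space Λ) :
    Summable fun t => y t • v t := by
  refine Summable.of_norm_bounded (l1Space_summable_norm y) fun t => ?_
  rw [norm_smul]
  exact mul_le_of_le_one_right (norm_nonneg _) (hv t)

/-- The contraction `l₁(Λ) → E` sending the basis vector `e_t` to `v t`. -/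
def l1Lift {Λ : Type} (v : Λ → E) (hv : ∀ t, ‖v t‖ ≤ 1) : l1Space Λ →L[ℂ] E :=
  LinearMap.mkContinuous
    { toFun := fun y => ∑' t, y t • v t
      map_add' := fun y z => by
        simp only [lp.coeFn_add, Pi.add_apply, add_smul]
        exact (l1Space_summable_smul hv y).tsum_add (l1Space_summable_smul hv z)
      map_smul' := fun c y => by
        simp only [lp.coeFn_smul, Pi.smul_apply, smul_assoc, RingHom.id_apply]
        exact (l1Space_summable_smul hv y).tsum_const_smul c } 1 fun y => by
    rw [one_mul, l1Space_norm_eq_tsum]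
    refine tsum_of_norm_bounded (l1Space_summable_norm y).hasSum fun t => ?_
    rw [norm_smul]
    exact mul_le_of_le_one_right (norm_nonneg _) (hv t)

theorem l1Lift_apply {Λ : Type} (v : Λ → E) (hv : ∀ t, ‖v t‖ ≤ 1) (y : l1Space Λ) :
    l1Lift v hv y = ∑' t, y t • v t := rfl

theorem norm_l1Lift_apply_le {Λ : Type} (v : Λ → E) (hv : ∀ t, ‖v t‖ ≤ 1) (y : l1Space Λ) :
    ‖l1Lift v hv y‖ ≤ ‖y‖ := by
  simpa using (l1Lift v hv).le_of_opNorm_le (LinearMap.mkContinuous_norm_le _ zero_le_one _) y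

theorem l1Lift_smul_l1single {Λ : Type} (v : Λ → E) (hv : ∀ t, ‖v t‖ ≤ 1) (c : ℂ) (t : Λ) :
    l1Lift v hv (c • l1single Λ t) = c • v t := by
  classical
  rw [map_smul, l1Lift_apply, tsum_eq_single t]
  · simp [l1single]
  · intro b hb
    simp [l1single, hb]

theorem norm_l1single {Λ : Type} (t : Λ) : ‖l1single Λ t‖ = 1 := by
  simp [l1single, lp.norm_single]

/-- The canonical coisometric operator from `l₁` of the closed unit ball. -/
def ballLift (E : Type) [NormedAddCommGroup E] [NormedSpace ℂ E] [CompleteSpace E] :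
    l1Space (Metric.closedBall (0 : E) 1) →L[ℂ] E :=
  l1Lift (fun t => (t : E)) fun t => mem_closedBall_zero_iff.1 t.2

theorem norm_ballLift_apply_le (y : l1Space (Metric.closedBall (0 : E) 1)) :
    ‖ballLift E y‖ ≤ ‖y‖ :=
  norm_l1Lift_apply_le _ _ y

theorem isCoisometry_ballLift : IsCoisometry (ballLift E) := by
  refine ⟨norm_ballLift_apply_le, fun x ε hε => ?_⟩
  have hx : ‖((‖x‖ : ℂ)⁻¹) • x‖ ≤ 1 := by
    rw [norm_smul, norm_inv, Complex.norm_real, norm_norm]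
    exact inv_mul_le_one
  refine ⟨(‖x‖ : ℂ) • l1single _ ⟨((‖x‖ : ℂ)⁻¹) • x, by simpa using hx⟩, ?_, ?_⟩
  · rw [ballLift, l1Lift_smul_l1single]
    rcases eq_or_ne x 0 with rfl | h
    · simp
    · rw [smul_smul, mul_inv_cancel₀ (by simpa using h), one_smul]
  · rw [norm_smul, norm_l1single]
    simpa using hε

end Lift

theorem l1Space_norm_sub_le {Λ : Type} (y z : l1Space Λ) (F : Finset Λ) :
    ‖y - z‖ ≤ ∑ t ∈ F, ‖y t - z t‖ + (‖y‖ - ∑ t ∈ F, ‖y t‖) + (‖z‖ - ∑ t ∈ F, ‖z t‖) := by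
  have hy := l1Space_summable_norm y
  have hz := l1Space_summable_norm z
  have hyz : Summable fun t => ‖y t - z t‖ := l1Space_summable_norm (y - z)
  have h := ((hy.add hz).sub hyz).sum_le_tsum F fun t _ => by
    linarith [norm_sub_le (y t) (z t)]
  rw [(hy.add hz).tsum_sub hyz, hy.tsum_add hz, Finset.sum_sub_distrib,
    Finset.sum_add_distrib] at h
  rw [l1Space_norm_eq_tsum y, l1Space_norm_eq_tsum z, l1Space_norm_eq_tsum (y - z)]
  simp only [lp.coeFn_sub, Pi.sub_apply]
  linarith

theorem exists_forall_lt_add {E : Type} [NormedAddCommGroup E]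
    {f : E → ℝ} {C η : ℝ} (hf : ∀ x, ‖x‖ ≤ 1 → f x ≤ C) (hη : 0 < η) : ∃ x₀, ‖x₀‖ ≤ 1 ∧ ∀ x, ‖x‖ ≤ 1 → f x < f x₀ + η := by
  have hne : (f '' {x | ‖x‖ ≤ 1}).Nonempty := ⟨f 0, 0, by simp, rfl⟩
  have hbdd : BddAbove (f '' {x | ‖x‖ ≤ 1}) := ⟨C, by rintro _ ⟨x, hx, rfl⟩; exact hf x hx⟩
  obtain ⟨_, ⟨x₀, hx₀, rfl⟩, h⟩ := exists_lt_of_lt_csSup hne (sub_lt_self _ hη)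
  exact ⟨x₀, hx₀, fun x hx => by linarith [le_csSup hbdd ⟨x, hx, rfl⟩]⟩

section Slices

variable {E : Type} [NormedAddCommGroup E] [NormedSpace ℂ E]

/-- The slice of width `α` of the closed unit ball determined by the functional `g`. -/
def ballSlice (g : StrongDual ℂ E) (α : ℝ) : Set E :=
  {x | ‖x‖ ≤ 1 ∧ ‖g‖ - α < (g x).re}

theorem re_apply_le_norm (g : StrongDual ℂ E) {x : E} (hx : ‖x‖ ≤ 1) : (g x).re ≤ ‖g‖ :=
  (Complex.re_le_norm _).trans (g.unit_le_opNorm x hx)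

theorem ballSlice_mono (g : StrongDual ℂ E) {α β : ℝ} (h : α ≤ β) :
    ballSlice g α ⊆ ballSlice g β :=
  fun _ hx => ⟨hx.1, by linarith [hx.2]⟩

theorem ballSlice_subset_of_norm_sub_le {g g' : StrongDual ℂ E} {α : ℝ} (hα : 0 < α)
    (h : ‖g' - g‖ ≤ α / 4) : ballSlice g' (α / 4) ⊆ ballSlice g α := by
  rintro x ⟨hx, hgx⟩
  refine ⟨hx, ?_⟩
  have h1 : (g' x).re - (g x).re ≤ α / 4 := by
    simpa using (re_apply_le_norm (g' - g) hx).trans h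
  have h2 : ‖g‖ - ‖g'‖ ≤ α / 4 := by
    rw [norm_sub_rev] at h
    exact (norm_sub_norm_le g g').trans h
  linarith

theorem ballSlice_nonempty (g : StrongDual ℂ E) {α : ℝ} (hα : 0 < α) :
    (ballSlice g α).Nonempty := by
  obtain ⟨x, hx, hgx⟩ := g.exists_lt_apply_of_lt_opNorm (sub_lt_self ‖g‖ hα)
  obtain ⟨c, hc, hcx⟩ := RCLike.exists_norm_eq_mul_self (g x)
  refine ⟨c • x, by rw [norm_smul, hc, one_mul]; exact hx.le, ?_⟩
  rw [map_smul, smul_eq_mul, ← hcx]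
  simpa using hgx

theorem mul_lt_of_mem_ballSlice {g : StrongDual ℂ E} {f q : E → ℝ} {c κ η : ℝ} {x₀ : E}
    (hx₀ : ‖x₀‖ ≤ 1) (hmax : ∀ x, ‖x‖ ≤ 1 → f x < f x₀ + η)
    (hq : ∀ x, (g x).re + κ * q x ≤ f x + c) (hg : f x₀ + c - η ≤ (g x₀).re) :
    ∀ x ∈ ballSlice g η, κ * q x < 3 * η := by
  rintro x ⟨hx, hgx⟩
  linarith [hmax x hx, hq x, re_apply_le_norm g hx₀]

theorem exists_ballSlice_tail_lt {Λ : Type} (ψ : E →L[ℂ] l1Space Λ) (g : StrongDual ℂ E)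
    {ρ η : ℝ} (hρ : 0 < ρ) (hη : 0 < η) :
    ∃ g' : StrongDual ℂ E, ‖g' - g‖ < ρ ∧ ∃ F : Finset Λ, ∃ α > 0,
      ∀ x ∈ ballSlice g' α, ‖ψ x‖ - ∑ t ∈ F, ‖ψ x t‖ < η := by
  set K := ‖ψ‖
  have hK : 0 ≤ K := norm_nonneg _
  set κ := ρ / (K + 1) with hκ_def
  have hκ : 0 < κ := by positivity
  have hκK : κ * K < ρ := by
    have : κ * (K + 1) = ρ := by rw [hκ_def]; field_simp
    linarith
  obtain ⟨x₀, hx₀, hmax⟩ := exists_forall_lt_add (E := E)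
    (f := fun x => (g x).re + κ * ‖ψ x‖) (C := ‖g‖ + κ * K) (η := κ * η / 3)
    (fun x hx => add_le_add (re_apply_le_norm g hx)
      (mul_le_mul_of_nonneg_left (ψ.unit_le_opNorm x hx) hκ.le)) (by positivity)
  obtain ⟨F, hF⟩ := l1Space_exists_finset (ψ x₀) (show 0 < η / 3 by positivity)
  choose u hu hux using fun t => RCLike.exists_norm_eq_mul_self (ψ x₀ t)
  set h : StrongDual ℂ E :=
    ∑ t ∈ F, u t • (lp.evalCLM ℂ (fun _ : Λ => ℂ) 1 t).comp ψ with h_def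
  have h_apply : ∀ x, h x = ∑ t ∈ F, u t * ψ x t := fun x => by
    simp [h_def, lp.evalCLM]
  have h_le : ∀ x, ‖h x‖ ≤ ∑ t ∈ F, ‖ψ x t‖ := fun x => by
    rw [h_apply]
    refine (norm_sum_le _ _).trans (le_of_eq ?_)
    simp [hu]
  have h_norm : ‖h‖ ≤ K := h.opNorm_le_bound hK fun x =>
    (h_le x).trans ((l1Space_sum_norm_le _ F).trans (ψ.le_opNorm x))
  have h_x₀ : (h x₀).re = ∑ t ∈ F, ‖ψ x₀ t‖ := by
    rw [h_apply, ← Finset.sum_congr rfl fun t _ => hux t]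
    simp
  refine ⟨g + (κ : ℂ) • h, ?_, F, κ * η / 3, by positivity, fun x hx => ?_⟩
  · rw [add_sub_cancel_left, norm_smul, Complex.norm_real, Real.norm_of_nonneg hκ.le]
    exact (mul_le_mul_of_nonneg_left h_norm hκ.le).trans_lt hκK
  · have := mul_lt_of_mem_ballSlice (c := 0) (κ := κ)
      (q := fun x => ‖ψ x‖ - ∑ t ∈ F, ‖ψ x t‖) hx₀ hmax (fun x => ?_) ?_ x hx
    · nlinarith
    · have := mul_le_mul_of_nonneg_left ((Complex.re_le_norm _).trans (h_le x)) hκ.le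
      simp
      linarith
    · simp [h_x₀]
      nlinarith

theorem exists_ballSlice_coord_lt {Λ : Type} (ψ : E →L[ℂ] l1Space Λ) (g : StrongDual ℂ E)
    (F : Finset Λ) {ρ r : ℝ} (hρ : 0 < ρ) (hr : 0 < r) :
    ∃ g' : StrongDual ℂ E, ‖g' - g‖ < ρ ∧ ∃ z : Λ → ℂ, ∃ α > 0,
      ∀ x ∈ ballSlice g' α, ∀ t ∈ F, ‖ψ x t - z t‖ < r := by
  set K := ‖ψ‖
  have hK : 0 ≤ K := norm_nonneg _
  set κ := ρ / (2 * (K * K + 1)) with hκ_def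
  have hκ : 0 < κ := by positivity
  have hκK : 2 * κ * (K * K) < ρ := by
    have : 2 * κ * (K * K + 1) = ρ := by rw [hκ_def]; field_simp
    linarith
  have hcoord : ∀ x, ‖x‖ ≤ 1 → ∀ t, ‖ψ x t‖ ≤ K := fun x hx t =>
    (lp.norm_apply_le_norm one_ne_zero _ t).trans (ψ.unit_le_opNorm x hx)
  obtain ⟨x₀, hx₀, hmax⟩ := exists_forall_lt_add (E := E)
    (f := fun x => (g x).re + κ * ∑ t ∈ F, ‖ψ x t‖ ^ 2) (C := ‖g‖ + κ * ∑ t ∈ F, K ^ 2)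
    (η := κ * r ^ 2 / 3)
    (fun x hx => add_le_add (re_apply_le_norm g hx)
      (mul_le_mul_of_nonneg_left (Finset.sum_le_sum fun t _ =>
        pow_le_pow_left₀ (norm_nonneg _) (hcoord x hx t) 2) hκ.le)) (by positivity)
  set h : StrongDual ℂ E := ∑ t ∈ F, starRingEnd ℂ (ψ x₀ t) •
    (lp.evalCLM ℂ (fun _ : Λ => ℂ) 1 t).comp ψ with h_def
  have h_apply : ∀ x, h x = ∑ t ∈ F, starRingEnd ℂ (ψ x₀ t) * ψ x t := fun x => by
    simp [h_def, lp.evalCLM]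
  have h_norm : ‖h‖ ≤ K * K := h.opNorm_le_bound (by positivity) fun x => by
    rw [h_apply]
    calc _ ≤ ∑ t ∈ F, ‖starRingEnd ℂ (ψ x₀ t) * ψ x t‖ := norm_sum_le _ _
      _ ≤ ∑ t ∈ F, K * ‖ψ x t‖ := Finset.sum_le_sum fun t _ => by
          rw [norm_mul, RCLike.norm_conj]
          exact mul_le_mul_of_nonneg_right (hcoord x₀ hx₀ t) (norm_nonneg _)
      _ ≤ K * (K * ‖x‖) := by
          rw [← Finset.mul_sum]
          exact mul_le_mul_of_nonneg_left
            ((l1Space_sum_norm_le _ F).trans (ψ.le_opNorm x)) hK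
      _ = K * K * ‖x‖ := by ring
  have h_re : ∀ x, 2 * (h x).re + ∑ t ∈ F, ‖ψ x t - ψ x₀ t‖ ^ 2 =
      ∑ t ∈ F, ‖ψ x t‖ ^ 2 + ∑ t ∈ F, ‖ψ x₀ t‖ ^ 2 := fun x => by
    rw [h_apply, Complex.re_sum, Finset.mul_sum, ← Finset.sum_add_distrib,
      ← Finset.sum_add_distrib]
    refine Finset.sum_congr rfl fun t _ => ?_
    simp only [Complex.sq_norm, Complex.normSq_apply, Complex.mul_re, Complex.conj_re,
      Complex.conj_im, Complex.sub_re, Complex.sub_im]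
    ring
  refine ⟨g + ((2 * κ : ℝ) : ℂ) • h, ?_, ψ x₀, κ * r ^ 2 / 3, by positivity,
    fun x hx t ht => ?_⟩
  · rw [add_sub_cancel_left, norm_smul, Complex.norm_real,
      Real.norm_of_nonneg (by positivity)]
    exact (mul_le_mul_of_nonneg_left h_norm (by positivity)).trans_lt hκK
  · have hre : ∀ x, ((g + ((2 * κ : ℝ) : ℂ) • h) x).re = (g x).re + κ * (2 * (h x).re) :=
      fun x => by
        rw [add_apply, Complex.add_re, smul_apply, smul_eq_mul, Complex.re_ofReal_mul]
        ring
    have := mul_lt_of_mem_ballSlice (c := κ * ∑ t ∈ F, ‖ψ x₀ t‖ ^ 2) (κ := κ)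
      (q := fun x => ∑ t ∈ F, ‖ψ x t - ψ x₀ t‖ ^ 2) hx₀ hmax (fun x => ?_) ?_ x hx
    · have hlt : ∑ t ∈ F, ‖ψ x t - ψ x₀ t‖ ^ 2 < r ^ 2 := by nlinarith
      have hle := Finset.single_le_sum (f := fun t => ‖ψ x t - ψ x₀ t‖ ^ 2)
        (fun t _ => by positivity) ht
      exact lt_of_pow_lt_pow_left₀ 2 hr.le (hle.trans_lt hlt)
    · rw [hre]
      have := congrArg (κ * ·) (h_re x)
      simp only [mul_add] at this ⊢
      linarith
    · rw [hre]
      have := congrArg (κ * ·) (h_re x₀)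
      simp only [sub_self, norm_zero, mul_add] at this
      have h0 : 0 ≤ κ * r ^ 2 / 3 := by positivity
      simp at this
      linarith

/-- The functional `g` determines slices of the closed unit ball of diameter less than `δ`. -/
def HasSmallSlice (δ : ℝ) (g : StrongDual ℂ E) : Prop :=
  ∃ α > 0, ∀ x ∈ ballSlice g α, ∀ y ∈ ballSlice g α, ‖x - y‖ < δ

theorem isOpen_hasSmallSlice (δ : ℝ) : IsOpen {g : StrongDual ℂ E | HasSmallSlice δ g} := by
  rw [Metric.isOpen_iff]
  rintro g ⟨α, hα, h⟩
  refine ⟨α / 4, by positivity, fun g' hg' => ⟨α / 4, by positivity, fun x hx y hy => ?_⟩⟩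
  rw [mem_ball_iff_norm] at hg'
  have hsub := ballSlice_subset_of_norm_sub_le hα hg'.le
  exact h x (hsub hx) y (hsub hy)

theorem dense_hasSmallSlice {Λ : Type} {ψ : E →L[ℂ] l1Space Λ} (hψ : ∀ x, ‖x‖ ≤ ‖ψ x‖)
    {δ : ℝ} (hδ : 0 < δ) : Dense {g : StrongDual ℂ E | HasSmallSlice δ g} := by
  rw [Metric.dense_iff]
  intro g ρ hρ
  obtain ⟨g₁, hg₁, F, α₁, hα₁, h₁⟩ :=
    exists_ballSlice_tail_lt ψ g (half_pos hρ) (show 0 < δ / 4 by positivity)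
  set r := δ / (4 * ((F.card : ℝ) + 1)) with hr_def
  have hr : 0 < r := by positivity
  have hFr : F.card * r < δ / 4 := by
    have : (F.card + 1) * r = δ / 4 := by rw [hr_def]; field_simp
    linarith
  obtain ⟨g₂, hg₂, z, α₂, hα₂, h₂⟩ := exists_ballSlice_coord_lt ψ g₁ F
    (show 0 < min (ρ / 2) (α₁ / 4) by positivity) hr
  have hsub := ballSlice_subset_of_norm_sub_le hα₁ (hg₂.le.trans (min_le_right _ _))
  refine ⟨g₂, ?_, min (α₁ / 4) α₂, by positivity, fun x hx y hy => ?_⟩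
  · rw [mem_ball_iff_norm]
    have := norm_sub_le_norm_sub_add_norm_sub g₂ g₁ g
    linarith [hg₂.trans_le (min_le_left _ _)]
  · have hx₁ := h₁ x (hsub (ballSlice_mono _ (min_le_left _ _) hx))
    have hy₁ := h₁ y (hsub (ballSlice_mono _ (min_le_left _ _) hy))
    have hx₂ := h₂ x (ballSlice_mono _ (min_le_right _ _) hx)
    have hy₂ := h₂ y (ballSlice_mono _ (min_le_right _ _) hy)
    have hsum : ∑ t ∈ F, ‖ψ x t - ψ y t‖ ≤ F.card * (2 * r) := by
      rw [← nsmul_eq_mul]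
      refine Finset.sum_le_card_nsmul _ _ _ fun t ht => ?_
      have := norm_sub_le_norm_sub_add_norm_sub (ψ x t) (z t) (ψ y t)
      rw [norm_sub_rev (z t)] at this
      linarith [hx₂ t ht, hy₂ t ht]
    have hxy := hψ (x - y)
    rw [map_sub] at hxy
    linarith [l1Space_norm_sub_le (ψ x) (ψ y) F]

/-- The functional `g` strongly exposes the point `s` of the closed unit ball. -/
def StronglyExposes (g : StrongDual ℂ E) (s : E) : Prop :=
  ‖s‖ = 1 ∧ g s = ‖g‖ ∧ ∀ δ > 0, ∃ α > 0, ∀ x ∈ ballSlice g α, ‖x - s‖ < δ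

theorem exists_stronglyExposes_of_hasSmallSlice [CompleteSpace E] {g : StrongDual ℂ E}
    (hg : g ≠ 0) (h : ∀ n : ℕ, HasSmallSlice (1 / ((n : ℝ) + 1)) g) :
    ∃ s, StronglyExposes g s := by
  have hsmall : ∀ δ > 0, HasSmallSlice δ g := fun δ hδ => by
    obtain ⟨n, hn⟩ := exists_nat_one_div_lt hδ
    obtain ⟨α, hα, hα'⟩ := h n
    exact ⟨α, hα, fun x hx y hy => (hα' x hx y hy).trans hn⟩
  choose x hx using fun n : ℕ => ballSlice_nonempty g (Nat.one_div_pos_of_nat (α := ℝ) (n := n))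
  have hmem : ∀ α > 0, ∃ N : ℕ, ∀ n ≥ N, x n ∈ ballSlice g α := fun α hα => by
    obtain ⟨N, hN⟩ := exists_nat_one_div_lt hα
    exact ⟨N, fun n hn => ballSlice_mono g
      ((Nat.one_div_le_one_div hn).trans hN.le) (hx n)⟩
  have hcauchy : CauchySeq x := by
    rw [Metric.cauchySeq_iff]
    intro δ hδ
    obtain ⟨α, hα, hα'⟩ := hsmall δ hδ
    obtain ⟨N, hN⟩ := hmem α hα
    exact ⟨N, fun m hm n hn => by rw [dist_eq_norm]; exact hα' _ (hN m hm) _ (hN n hn)⟩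
  obtain ⟨s, hs⟩ := cauchySeq_tendsto_of_complete hcauchy
  have hs1 : ‖s‖ ≤ 1 := le_of_tendsto' hs.norm fun n => (hx n).1
  have hre : Filter.Tendsto (fun n => (g (x n)).re) Filter.atTop (nhds (g s).re) :=
    (Complex.continuous_re.tendsto _).comp ((g.continuous.tendsto s).comp hs)
  have hgs : ‖g‖ ≤ (g s).re := by
    refine le_of_forall_pos_sub_le fun α hα => ge_of_tendsto hre ?_
    obtain ⟨N, hN⟩ := hmem α hα
    exact Filter.eventually_atTop.2 ⟨N, fun n hn => (hN n hn).2.le⟩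
  have hle : ‖g s‖ ≤ ‖g‖ := g.unit_le_opNorm s hs1
  have hgs' : g s = ‖g‖ := by
    have hre_eq : (g s).re = ‖g‖ := le_antisymm (re_apply_le_norm g hs1) hgs
    have him : (g s).im = 0 := Complex.abs_re_eq_norm.1
      (le_antisymm (Complex.abs_re_le_norm _) (hle.trans (hgs.trans (le_abs_self _))))
    exact Complex.ext (by simpa using hre_eq) (by simpa using him)
  refine ⟨s, le_antisymm hs1 ?_, hgs', fun δ hδ => ?_⟩
  · have hpos := norm_pos_iff.2 hg
    have := hgs.trans ((Complex.re_le_norm _).trans (g.le_opNorm s))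
    exact le_of_mul_le_mul_left (by simpa using this) hpos
  · obtain ⟨α, hα, hα'⟩ := hsmall δ hδ
    exact ⟨α, hα, fun y hy => hα' y hy s ⟨hs1, by linarith⟩⟩

theorem dense_stronglyExposes [CompleteSpace E] {Λ : Type} {ψ : E →L[ℂ] l1Space Λ}
    (hψ : ∀ x, ‖x‖ ≤ ‖ψ x‖) (g : StrongDual ℂ E) (hg : g ≠ 0) :
    ∃ g' s, ‖g' - g‖ < ‖g‖ / 2 ∧ StronglyExposes g' s := by
  have hdense : Dense (⋂ n : ℕ, {g : StrongDual ℂ E | HasSmallSlice (1 / ((n : ℝ) + 1)) g}) :=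
    dense_iInter_of_isOpen (fun _ => isOpen_hasSmallSlice _)
      fun _ => dense_hasSmallSlice hψ Nat.one_div_pos_of_nat
  obtain ⟨g', hball, hg'⟩ := Metric.dense_iff.1 hdense g (‖g‖ / 2) (by positivity)
  rw [mem_ball_iff_norm] at hball
  have hne : g' ≠ 0 := by
    rintro rfl
    rw [zero_sub, norm_neg] at hball
    linarith [norm_nonneg g]
  obtain ⟨s, hs⟩ := exists_stronglyExposes_of_hasSmallSlice hne (Set.mem_iInter.1 hg')
  exact ⟨g', s, hball, hs⟩

end Slices

section Grothendieck

variable {E : Type} [NormedAddCommGroup E] [NormedSpace ℂ E]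

/-- A nonzero functional vanishing on a proper closed subspace. -/
theorem exists_dual_ne_zero_of_isClosed {V : Submodule ℂ E} (hV : IsClosed (V : Set E))
    (hne : V ≠ ⊤) : ∃ g : StrongDual ℂ E, g ≠ 0 ∧ ∀ x ∈ V, g x = 0 := by
  obtain ⟨x, hx⟩ : ∃ x, x ∉ V := by
    by_contra! h
    exact hne (Submodule.eq_top_iff'.2 h)
  have : IsClosed (V.toAddSubgroup : Set E) := hV
  have hx0 : V.mkQL x ≠ 0 := fun h => hx ((Submodule.Quotient.mk_eq_zero V).1 h)
  obtain ⟨f, -, hf⟩ := exists_dual_vector ℂ (V.mkQL x) (norm_ne_zero_iff.2 hx0)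
  refine ⟨f.comp V.mkQL, fun h => ?_, fun y hy => ?_⟩
  · have := congrArg (fun k : StrongDual ℂ E => k x) h
    simp only [ContinuousLinearMap.comp_apply, hf, zero_apply] at this
    exact hx0 (norm_eq_zero.1 (Complex.ofReal_eq_zero.1 this))
  · have : V.mkQL y = 0 := (Submodule.Quotient.mk_eq_zero V).2 hy
    simp [this]

theorem exists_pos_le_norm_sub_smul {x y : E} (hx : x ≠ 0)
    (h : Submodule.span ℂ {x} ≠ Submodule.span ℂ {y}) :
    ∃ d > 0, ∀ u : ℂ, d ≤ ‖x - u • y‖ := by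
  have hmem : x ∉ (Submodule.span ℂ {y} : Set E) := fun hxy => by
    obtain ⟨c, rfl⟩ := Submodule.mem_span_singleton.1 hxy
    have hc : c ≠ 0 := by
      rintro rfl
      simp at hx
    exact h (Submodule.span_singleton_smul_eq (isUnit_iff_ne_zero.2 hc) y)
  have hclosed := (Submodule.span ℂ {y}).closed_of_finiteDimensional
  refine ⟨_, (hclosed.notMem_iff_infDist_pos (Submodule.nonempty _)).1 hmem, fun u => ?_⟩
  rw [← dist_eq_norm]
  exact Metric.infDist_le_dist_of_mem (Submodule.mem_span_singleton.2 ⟨u, rfl⟩)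

/-- The points of the closed unit ball lying within `δ` of the circle through `s`. -/
def nearCircle (s : E) (δ : ℝ) : Set (Metric.closedBall (0 : E) 1) :=
  {t | ∃ u : ℂ, ‖u‖ = 1 ∧ ‖u • (t : E) - s‖ < δ}

theorem nearCircle_disjoint {s s' : E} {δ : ℝ} (h : ∀ u : ℂ, 2 * δ ≤ ‖s - u • s'‖)
    {t : Metric.closedBall (0 : E) 1} (ht : t ∈ nearCircle s δ) : t ∉ nearCircle s' δ := by
  obtain ⟨u, hu, hus⟩ := ht
  rintro ⟨v, hv, hvs⟩
  have hv0 : v ≠ 0 := norm_ne_zero_iff.1 (by simp [hv])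
  have h1 : ‖(u * v⁻¹) • (v • (t : E) - s')‖ < δ := by
    rw [norm_smul, norm_mul, norm_inv, hu, hv]
    simpa using hvs
  have h2 : s - (u * v⁻¹) • s' = (u * v⁻¹) • (v • (t : E) - s') - (u • (t : E) - s) := by
    rw [smul_sub, smul_smul, mul_assoc, inv_mul_cancel₀ hv0, mul_one]
    abel
  have h3 := h (u * v⁻¹)
  rw [h2] at h3
  linarith [norm_sub_le ((u * v⁻¹) • (v • (t : E) - s')) (u • (t : E) - s)]

variable [CompleteSpace E]

theorem StronglyExposes.exists_mass_le {g : StrongDual ℂ E} {s : E} (hg : StronglyExposes g s)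
    {δ : ℝ} (hδ : 0 < δ) : ∃ C : ℝ, ∀ ε : ℝ, ∀ y : l1Space (Metric.closedBall (0 : E) 1),
      ballLift E y = s → ‖y‖ ≤ 1 + ε →
        ∑' t, (nearCircle s δ)ᶜ.indicator (fun t => ‖y t‖) t ≤ C * ε := by
  obtain ⟨hs, hgs, hexp⟩ := hg
  obtain ⟨α, hα, h⟩ := hexp δ hδ
  have hfar : ∀ t ∉ nearCircle s δ, ‖g (t : E)‖ ≤ ‖g‖ - α := fun t ht => by
    by_contra! hlt
    obtain ⟨u, hu, hut⟩ := RCLike.exists_norm_eq_mul_self (g (t : E))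
    refine ht ⟨u, hu, h _ ⟨?_, ?_⟩⟩
    · rw [norm_smul, hu, one_mul]
      exact mem_closedBall_zero_iff.1 t.2
    · rw [map_smul, smul_eq_mul, ← hut]
      simpa using hlt
  refine ⟨‖g‖ / α, fun ε y hy hyε => ?_⟩
  have hsum := l1Space_summable_norm y
  have hind := hsum.indicator (nearCircle s δ)ᶜ
  have hbound : ‖g s‖ ≤ ‖g‖ * ‖y‖ -
      α * ∑' t, (nearCircle s δ)ᶜ.indicator (fun t => ‖y t‖) t := by
    have hgy : g s = ∑' t, g (y t • (t : E)) := by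
      rw [← hy, ballLift, l1Lift_apply, g.map_tsum (l1Space_summable_smul _ y)]
      exact fun t => mem_closedBall_zero_iff.1 t.2
    rw [hgy, l1Space_norm_eq_tsum]
    refine tsum_of_norm_bounded
      ((hsum.hasSum.mul_left ‖g‖).sub (hind.hasSum.mul_left α)) fun t => ?_
    rw [map_smul, norm_smul]
    by_cases ht : t ∈ nearCircle s δ
    · have := g.unit_le_opNorm (t : E) (mem_closedBall_zero_iff.1 t.2)
      simp only [Set.indicator, Set.mem_compl_iff, ht, not_true, if_false]
      nlinarith [norm_nonneg (y t)]
    · simp only [Set.indicator, Set.mem_compl_iff, ht, not_false_iff, if_true]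
      nlinarith [norm_nonneg (y t), hfar t ht]
  rw [hgs, Complex.norm_real, norm_norm] at hbound
  rw [div_mul_eq_mul_div, le_div_iff₀ hα]
  nlinarith [norm_nonneg g]

theorem sum_norm_le_norm_sum_of_disjoint {ι T : Type} (F : Finset ι) (N : ι → Set T)
    (hN : ∀ i ∈ F, ∀ j ∈ F, i ≠ j → ∀ t ∈ N i, t ∉ N j) (a : ι → l1Space T) (c : ι → ℂ) :
    ∑ i ∈ F, ‖c i‖ * (‖a i‖ - 2 * ∑' t, (N i)ᶜ.indicator (fun t => ‖a i t‖) t) ≤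
      ‖∑ i ∈ F, c i • a i‖ := by
  classical
  have hs : HasSum (fun t => ∑ i ∈ F, ‖c i‖ *
      (‖a i t‖ - 2 * (N i)ᶜ.indicator (fun t => ‖a i t‖) t))
      (∑ i ∈ F, ‖c i‖ * (‖a i‖ - 2 * ∑' t, (N i)ᶜ.indicator (fun t => ‖a i t‖) t)) :=
    hasSum_sum fun i _ => by
      have hsum := l1Space_summable_norm (a i)
      rw [l1Space_norm_eq_tsum]
      exact (hsum.hasSum.sub ((hsum.indicator _).hasSum.mul_left 2)).mul_left _
  rw [l1Space_norm_eq_tsum]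
  refine hasSum_le (fun t => ?_) hs (l1Space_summable_norm _).hasSum
  have happ : (∑ i ∈ F, c i • a i : l1Space T) t = ∑ i ∈ F, c i * a i t := by
    rw [lp.coeFn_sum, Finset.sum_apply]
    rfl
  rw [happ]
  have hout : ∀ i, t ∉ N i → ‖c i‖ * (‖a i t‖ - 2 * (N i)ᶜ.indicator (fun t => ‖a i t‖) t) =
      -‖c i * a i t‖ := fun i hi => by
    simp [Set.indicator, hi]
    ring
  by_cases hex : ∃ k ∈ F, t ∈ N k
  · obtain ⟨k, hk, hkt⟩ := hex
    rw [← Finset.add_sum_erase F _ hk, ← Finset.add_sum_erase F (fun i => c i * a i t) hk]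
    have hrest : ∑ i ∈ F.erase k, ‖c i‖ *
        (‖a i t‖ - 2 * (N i)ᶜ.indicator (fun t => ‖a i t‖) t) =
        -∑ i ∈ F.erase k, ‖c i * a i t‖ := by
      rw [← Finset.sum_neg_distrib]
      refine Finset.sum_congr rfl fun i hi => hout i ?_
      obtain ⟨hik, hi⟩ := Finset.mem_erase.1 hi
      exact hN k hk i hi hik.symm t hkt
    have hkk : ‖c k‖ * (‖a k t‖ - 2 * (N k)ᶜ.indicator (fun t => ‖a k t‖) t) =
        ‖c k * a k t‖ := by
      simp [Set.indicator, hkt]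
    rw [hrest, hkk]
    have h1 := norm_sub_le_norm_add (c k * a k t) (∑ i ∈ F.erase k, c i * a i t)
    have h2 := norm_sum_le (F.erase k) fun i => c i * a i t
    linarith
  · push Not at hex
    rw [Finset.sum_congr rfl fun i hi => hout i (hex i hi), Finset.sum_neg_distrib]
    exact (neg_nonpos.2 (Finset.sum_nonneg fun _ _ => norm_nonneg _)).trans (norm_nonneg _)

/-- The canonical operator `l₁(ball E) → E` has linear right inverses of norm close to one. -/
def HasNearIsometricBallSections (E : Type) [NormedAddCommGroup E] [NormedSpace ℂ E]
    [CompleteSpace E] : Prop :=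
  ∀ ε > 0, ∃ ψ : E →L[ℂ] l1Space (Metric.closedBall (0 : E) 1),
    (∀ x, ballLift E (ψ x) = x) ∧ ∀ x, ‖ψ x‖ ≤ (1 + ε) * ‖x‖

theorem sum_norm_le_norm_sum_smul (hE : HasNearIsometricBallSections E) {ι : Type}
    {s : ι → E} {g : ι → StrongDual ℂ E} (hg : ∀ i, StronglyExposes (g i) (s i))
    (hsep : ∀ i j, i ≠ j → ∃ d > 0, ∀ u : ℂ, d ≤ ‖s i - u • s j‖) (F : Finset ι) (c : ι → ℂ) :
    ∑ i ∈ F, ‖c i‖ ≤ ‖∑ i ∈ F, c i • s i‖ := by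
  obtain ⟨δ, hδsep, hδ⟩ : ∃ δ : ℝ, (∀ i ∈ F, ∀ j ∈ F, i ≠ j →
      ∀ u : ℂ, 2 * δ ≤ ‖s i - u • s j‖) ∧ 0 < δ := by
    have hev : ∀ᶠ δ : ℝ in nhdsWithin 0 (Set.Ioi 0), ∀ i ∈ F, ∀ j ∈ F, i ≠ j →
        ∀ u : ℂ, 2 * δ ≤ ‖s i - u • s j‖ := by
      refine (Filter.eventually_all_finset F).2 fun i _ =>
        (Filter.eventually_all_finset F).2 fun j _ => ?_
      by_cases hij : i = j
      · simp [hij]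
      obtain ⟨d, hd, hdu⟩ := hsep i j hij
      filter_upwards [nhdsWithin_le_nhds (gt_mem_nhds (half_pos hd))] with δ hδ _ u
      linarith [hdu u]
    exact (hev.and self_mem_nhdsWithin).exists
  choose C hC using fun i => (hg i).exists_mass_le hδ
  set x := ∑ i ∈ F, c i • s i with hx
  have key : ∀ ε > 0, ∑ i ∈ F, ‖c i‖ - ‖x‖ ≤ (‖x‖ + 2 * ∑ i ∈ F, ‖c i‖ * C i) * ε := by
    intro ε hε
    obtain ⟨ψ, hψ, hψn⟩ := hE ε hε
    have h1 := sum_norm_le_norm_sum_of_disjoint F (fun i => nearCircle (s i) δ)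
      (fun i hi j hj hij t ht => nearCircle_disjoint (hδsep i hi j hj hij) ht)
      (fun i => ψ (s i)) c
    have h2 : ∑ i ∈ F, c i • ψ (s i) = ψ x := by simp [hx]
    rw [h2] at h1
    have h3 : ∑ i ∈ F, ‖c i‖ * (1 - 2 * (C i * ε)) ≤ ‖ψ x‖ := by
      refine le_trans (Finset.sum_le_sum fun i _ =>
        mul_le_mul_of_nonneg_left ?_ (norm_nonneg _)) h1
      have hlow : 1 ≤ ‖ψ (s i)‖ := by
        simpa [hψ, (hg i).1] using norm_ballLift_apply_le (ψ (s i))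
      have hup : ‖ψ (s i)‖ ≤ 1 + ε := by simpa [(hg i).1] using hψn (s i)
      linarith [hC i ε _ (hψ (s i)) hup]
    have h4 : ∑ i ∈ F, ‖c i‖ * (1 - 2 * (C i * ε)) =
        ∑ i ∈ F, ‖c i‖ - (2 * ∑ i ∈ F, ‖c i‖ * C i) * ε := by
      rw [Finset.mul_sum, Finset.sum_mul, ← Finset.sum_sub_distrib]
      exact Finset.sum_congr rfl fun i _ => by ring
    linarith [hψn x]
  set A := ‖x‖ + 2 * ∑ i ∈ F, ‖c i‖ * C i
  have hlim : Filter.Tendsto (fun ε : ℝ => A * ε) (nhdsWithin 0 (Set.Ioi 0)) (nhds 0) := by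
    have : Filter.Tendsto (fun ε : ℝ => A * ε) (nhds 0) (nhds (A * 0)) :=
      (continuous_const_mul A).tendsto 0
    rw [mul_zero] at this
    exact this.mono_left nhdsWithin_le_nhds
  have := ge_of_tendsto hlim (Filter.eventually_of_mem self_mem_nhdsWithin key)
  linarith

theorem norm_l1Lift_apply_eq {Λ : Type} {v : Λ → E} (hv : ∀ t, ‖v t‖ ≤ 1)
    (h : ∀ (F : Finset Λ) (c : Λ → ℂ), ∑ i ∈ F, ‖c i‖ ≤ ‖∑ i ∈ F, c i • v i‖) (y : l1Space Λ) :
    ‖l1Lift v hv y‖ = ‖y‖ := by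
  refine le_antisymm (norm_l1Lift_apply_le v hv y) ?_
  rw [l1Space_norm_eq_tsum]
  exact le_of_tendsto_of_tendsto' (l1Space_summable_norm y).hasSum
    (l1Space_summable_smul hv y).hasSum.norm fun F => h F fun t => y t

/-- Grothendieck: a Banach space over which the canonical operator from `l₁` of its ball has
right inverses of norm close to one is isometrically isomorphic to some `l₁(Λ)`. -/
theorem HasNearIsometricBallSections.exists_linearIsometryEquiv
    (hE : HasNearIsometricBallSections E) : ∃ Λ : Type, Nonempty (l1Space Λ ≃ₗᵢ[ℂ] E) := by
  let Λ : Type := {L : Submodule ℂ E // ∃ g s, StronglyExposes g s ∧ Submodule.span ℂ {s} = L}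
  choose g s hg hs using fun L : Λ => L.2
  have hle : ∀ i, ‖s i‖ ≤ 1 := fun i => (hg i).1.le
  have hsep : ∀ i j, i ≠ j → ∃ d > 0, ∀ u : ℂ, d ≤ ‖s i - u • s j‖ := fun i j hij => by
    refine exists_pos_le_norm_sub_smul (norm_ne_zero_iff.1 (by simp [(hg i).1])) ?_
    rw [hs, hs]
    exact fun h => hij (Subtype.ext h)
  have hnorm := norm_l1Lift_apply_eq hle (sum_norm_le_norm_sum_smul hE hg hsep)
  let J : l1Space Λ →ₗᵢ[ℂ] E := ⟨(l1Lift s hle).toLinearMap, hnorm⟩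
  have hmem : ∀ g' s', StronglyExposes g' s' → s' ∈ LinearMap.range J.toLinearMap := by
    intro g' s' h
    let L : Λ := ⟨Submodule.span ℂ {s'}, g', s', h, rfl⟩
    have : s' ∈ Submodule.span ℂ {s L} := by
      rw [hs L]
      exact Submodule.mem_span_singleton_self s'
    obtain ⟨c, hc⟩ := Submodule.mem_span_singleton.1 this
    exact ⟨c • l1single Λ L, (l1Lift_smul_l1single s hle c L).trans hc⟩
  have hsurj : LinearMap.range J.toLinearMap = ⊤ := by
    by_contra hne
    have hclosed : IsClosed (LinearMap.range J.toLinearMap : Set E) := by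
      rw [LinearMap.coe_range]
      exact J.isometry.isClosedEmbedding.isClosed_range
    obtain ⟨k, hk, hk0⟩ := exists_dual_ne_zero_of_isClosed hclosed hne
    obtain ⟨ψ, hψ, -⟩ := hE 1 one_pos
    have hψ' : ∀ x, ‖x‖ ≤ ‖ψ x‖ := fun x => by
      simpa [hψ] using norm_ballLift_apply_le (ψ x)
    obtain ⟨g', s', hclose, hexp⟩ := dense_stronglyExposes hψ' k hk
    have h1 : ‖g' s'‖ ≤ ‖g' - k‖ := by
      have := (g' - k).unit_le_opNorm s' hexp.1.le
      rwa [sub_apply, hk0 s' (hmem g' s' hexp), sub_zero] at this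
    rw [hexp.2.1, Complex.norm_real, norm_norm] at h1
    have h2 := norm_sub_norm_le k g'
    rw [norm_sub_rev] at h2
    linarith
  exact ⟨Λ, ⟨LinearIsometryEquiv.ofSurjective J (LinearMap.range_eq_top.1 hsurj)⟩⟩

end Grothendieck

theorem ExtremelyProjectiveNor.hasNearIsometricBallSections {P : Type} [NormedAddCommGroup P]
    [NormedSpace ℂ P] (hP : ExtremelyProjectiveNor P) :
    HasNearIsometricBallSections (UniformSpace.Completion P) := by
  intro ε hε
  let φ : P →L[ℂ] UniformSpace.Completion P := UniformSpace.Completion.toComplL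
  have hφ : ‖φ‖ ≤ 1 := φ.opNorm_le_bound zero_le_one fun x => by simp [φ]
  have hdense : DenseRange φ.toLinearMap := UniformSpace.Completion.denseRange_coe
  obtain ⟨ψ, hψ, hψn⟩ := hP _ _ (ballLift (UniformSpace.Completion P)) isCoisometry_ballLift φ ε hε
  have hbound : ∀ x, ‖ψ.toLinearMap x‖ ≤ (1 + ε) * ‖φ.toLinearMap x‖ := fun x => by
    have : ‖φ.toLinearMap x‖ = ‖x‖ := UniformSpace.Completion.norm_coe x
    rw [this]
    exact ψ.le_of_opNorm_le (by linarith) x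
  refine ⟨ψ.toLinearMap.extendOfNorm φ.toLinearMap, fun x => ?_,
    LinearMap.norm_extendOfNorm_apply_le hdense _ hbound⟩
  refine congrFun (hdense.equalizer
    (g := fun x => ballLift _ (ψ.toLinearMap.extendOfNorm φ.toLinearMap x)) (h := id)
    (by fun_prop) continuous_id ?_) x
  ext p
  simp only [Function.comp_apply, LinearMap.extendOfNorm_eq hdense ⟨_, hbound⟩, id]
  exact congrArg (fun k : P →L[ℂ] UniformSpace.Completion P => k p) hψ

/-- If a normed space `P` is extremely projective in Nor, then `P` is isometrically
isomorphic to a dense subspace of `l₁(Λ)` for some index set `Λ`. -/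
theorem extremelyProjectiveNor_dense_subspace_l1
    (P : Type) [NormedAddCommGroup P] [NormedSpace ℂ P]
    (hP : ExtremelyProjectiveNor P) :
    ∃ (Λ : Type) (ι : P →ₗᵢ[ℂ] l1Space Λ), DenseRange ι := by
  obtain ⟨Λ, ⟨J⟩⟩ := hP.hasNearIsometricBallSections.exists_linearIsometryEquiv
  refine ⟨Λ, J.symm.toLinearIsometry.comp UniformSpace.Completion.toComplₗᵢ, ?_⟩
  exact J.symm.surjective.denseRange.comp UniformSpace.Completion.denseRange_coe
    J.symm.continuous

end
end

section
/- Let P be a separable normed space which is topologically projective in Nor (in particular, extremely projective in Nor). Then P has at most countable linear (Hamel) dimension. -/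
noncomputable section

/-- Finitely supported complex functions on `Λ`, to be equipped with the `ℓ¹`-norm. -/
def FinsuppL1 (Λ : Type) : Type := Λ →₀ ℂ

namespace FinsuppL1

variable {Λ : Type}

instance : AddCommGroup (FinsuppL1 Λ) := inferInstanceAs (AddCommGroup (Λ →₀ ℂ))

instance : Module ℂ (FinsuppL1 Λ) := inferInstanceAs (Module ℂ (Λ →₀ ℂ))

/-- The underlying finitely supported function. -/
def toFinsupp : FinsuppL1 Λ ≃ₗ[ℂ] (Λ →₀ ℂ) := LinearEquiv.refl ℂ (Λ →₀ ℂ)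

instance : Norm (FinsuppL1 Λ) := ⟨fun f => (toFinsupp f).sum fun _ c => ‖c‖⟩

lemma norm_def (f : FinsuppL1 Λ) : ‖f‖ = (toFinsupp f).sum fun _ c => ‖c‖ := rfl

lemma norm_apply_le (f : FinsuppL1 Λ) (ν : Λ) : ‖toFinsupp f ν‖ ≤ ‖f‖ := by
  by_cases hν : ν ∈ (toFinsupp f).support
  · exact Finset.single_le_sum (f := fun i => ‖toFinsupp f i‖) (fun _ _ => norm_nonneg _) hν
  · rw [Finsupp.notMem_support_iff.mp hν, norm_zero]
    exact Finset.sum_nonneg fun _ _ => norm_nonneg _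

lemma normedSpaceCore : NormedSpace.Core ℂ (FinsuppL1 Λ) where
  norm_nonneg f := Finset.sum_nonneg fun _ _ => norm_nonneg _
  norm_smul c f := by
    rw [norm_def, norm_def, map_smul, Finsupp.sum_smul_index (by simp)]
    simp [Finsupp.sum, Finset.mul_sum]
  norm_triangle f g := by
    classical
    simp only [norm_def]
    rw [map_add, Finsupp.sum_of_support_subset (toFinsupp f + toFinsupp g) Finsupp.support_add _
        (by simp),
      Finsupp.sum_of_support_subset (toFinsupp f) Finset.subset_union_left _ (by simp),
      Finsupp.sum_of_support_subset (toFinsupp g) Finset.subset_union_right _ (by simp),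
      ← Finset.sum_add_distrib]
    exact Finset.sum_le_sum fun i _ => norm_add_le (toFinsupp f i) (toFinsupp g i)
  norm_eq_zero_iff f := by
    refine ⟨fun hf => ?_, fun hf => by simp [hf, norm_def]⟩
    refine toFinsupp.injective (Finsupp.ext fun ν => ?_)
    simpa [hf] using norm_apply_le f ν

instance : NormedAddCommGroup (FinsuppL1 Λ) := NormedAddCommGroup.ofCore normedSpaceCore

instance : NormedSpace ℂ (FinsuppL1 Λ) := NormedSpace.ofCore normedSpaceCore

/-- Evaluation at a point, as a bounded functional. -/
def eval (ν : Λ) : FinsuppL1 Λ →L[ℂ] ℂ :=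
  ((Finsupp.lapply ν).comp toFinsupp.toLinearMap).mkContinuous 1 fun f => by
    simpa using norm_apply_le f ν

lemma eval_apply (ν : Λ) (f : FinsuppL1 Λ) : eval ν f = toFinsupp f ν := rfl

variable (P : Type) [NormedAddCommGroup P] [NormedSpace ℂ P]

lemma norm_linearCombination_le (f : FinsuppL1 (Metric.closedBall (0 : P) 1)) :
    ‖Finsupp.linearCombination ℂ Subtype.val (toFinsupp f)‖ ≤ ‖f‖ := by
  rw [Finsupp.linearCombination_apply, norm_def]
  refine (norm_sum_le _ _).trans (Finset.sum_le_sum fun ν _ => ?_)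
  rw [norm_smul]
  exact mul_le_of_le_one_right (norm_nonneg _) (mem_closedBall_zero_iff.mp ν.2)

/-- The canonical map onto `P` from the finitely supported functions on its unit ball. -/
def toSpace : FinsuppL1 (Metric.closedBall (0 : P) 1) →L[ℂ] P :=
  ((Finsupp.linearCombination ℂ Subtype.val).comp toFinsupp.toLinearMap).mkContinuous 1 fun f => by
    simpa using norm_linearCombination_le P f

lemma isCoisometry_toSpace : IsCoisometry (toSpace P) := by
  refine ⟨norm_linearCombination_le P, fun x ε hε => ?_⟩
  rcases eq_or_ne x 0 with rfl | hx
  · exact ⟨0, map_zero _, by simpa using hε⟩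
  have hx' : ‖x‖ ≠ 0 := norm_ne_zero_iff.mpr hx
  let ν : Metric.closedBall (0 : P) 1 :=
    ⟨((‖x‖ : ℂ)⁻¹) • x, by simp [norm_smul, hx']⟩
  refine ⟨toFinsupp.symm (Finsupp.single ν (‖x‖ : ℂ)), ?_, ?_⟩
  · change Finsupp.linearCombination ℂ Subtype.val (Finsupp.single ν (‖x‖ : ℂ)) = x
    rw [Finsupp.linearCombination_single]
    exact smul_inv_smul₀ (by exact_mod_cast hx') x
  · rw [norm_def, LinearEquiv.apply_symm_apply, Finsupp.sum_single_index (by simp)]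
    simpa using hε

variable {P}

/-- A bounded operator from a separable space into `FinsuppL1 Λ` takes values in the functions
supported on a fixed countable set. -/
lemma exists_countable_supported [TopologicalSpace.SeparableSpace P] (ψ : P →L[ℂ] FinsuppL1 Λ) :
    ∃ S : Set Λ, S.Countable ∧ ∀ x, toFinsupp (ψ x) ∈ Finsupp.supported ℂ ℂ S := by
  obtain ⟨D, hDc, hD⟩ := TopologicalSpace.exists_countable_dense P
  refine ⟨⋃ d ∈ D, ((toFinsupp (ψ d)).support : Set Λ),
    hDc.biUnion fun d _ => Finset.countable_toSet _, fun x => ?_⟩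
  rw [Finsupp.mem_supported']
  intro ν hν
  have h : (eval ν).comp ψ = 0 := by
    refine ContinuousLinearMap.ext_on (hD.mono Submodule.subset_span) fun d hd => ?_
    simp only [Set.mem_iUnion, not_exists] at hν
    simpa [eval_apply] using hν d hd
  exact DFunLike.congr_fun h x

lemma rank_le_aleph0_of_injective [TopologicalSpace.SeparableSpace P]
    (ψ : P →L[ℂ] FinsuppL1 Λ) (hψ : Function.Injective ψ) :
    Module.rank ℂ P ≤ Cardinal.aleph0 := by
  obtain ⟨S, hS, hψS⟩ := exists_countable_supported ψ
  let χ : P →ₗ[ℂ] Finsupp.supported ℂ ℂ S :=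
    (toFinsupp.toLinearMap.comp ψ.toLinearMap).codRestrict _ hψS
  have hχ : Function.Injective χ := fun x y hxy =>
    hψ (toFinsupp.injective (congrArg Subtype.val hxy))
  calc Module.rank ℂ P ≤ Module.rank ℂ (Finsupp.supported ℂ ℂ S) :=
        LinearMap.rank_le_of_injective χ hχ
    _ = Module.rank ℂ (S →₀ ℂ) := (Finsupp.supportedEquivFinsupp S).rank_eq
    _ = Cardinal.mk S := rank_finsupp_self' ℂ
    _ ≤ Cardinal.aleph0 := hS.le_aleph0

end FinsuppL1

/-- A separable normed space which is topologically projective in Nor (in particular any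
extremely projective one) has at most countable linear (Hamel) dimension. -/
theorem separable_topologicallyProjective_rank_le_aleph0
    (P : Type) [NormedAddCommGroup P] [NormedSpace ℂ P]
    [TopologicalSpace.SeparableSpace P]
    (hP : TopologicallyProjectiveNor P) :
    Module.rank ℂ P ≤ Cardinal.aleph0 := by
  obtain ⟨ψ, hψ⟩ := hP _ P (FinsuppL1.toSpace P) (FinsuppL1.isCoisometry_toSpace P)
    (ContinuousLinearMap.id ℂ P)
  exact FinsuppL1.rank_le_aleph0_of_injective ψ <|
    Function.LeftInverse.injective (g := FinsuppL1.toSpace P) (DFunLike.congr_fun hψ)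

end
end

section
/- Let A be a sequence algebra and P a homogeneous normed A-module of finite type such that for every n the n-th coordinate subspace Pₙ is (isometrically) l₁⁰(Λₙ) for some index set Λₙ. Then P is extremely projective with respect to the class H of all essential homogeneous normed A-modules. -/
noncomputable section

open Filter Topology

variable {A : Type} [NonUnitalNormedRing A] [NormedSpace ℂ A]
  [IsScalarTower ℂ A A] [SMulCommClass ℂ A A]

variable (SA : SequenceAlgebra A)

section Auxiliary

omit [IsScalarTower ℂ A A] [SMulCommClass ℂ A A]

namespace SequenceAlgebra

lemma p_mul (n : ℕ) (a : A) : SA.p n * a = SA.coords a n • SA.p n := by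
  apply SA.coords_injective
  rw [SA.coords_mul, map_smul, SA.coords_p]
  ext m
  by_cases h : m = n <;> simp [h]

lemma p_smul_smul (M : NormedMod A) (n : ℕ) (a : A) (x : M.X) :
    M.smul (SA.p n) (M.smul a x) = SA.coords a n • M.smul (SA.p n) x := by
  rw [← M.mul_smul, SA.p_mul, M.csmul_smul]

lemma p_smul_p_smul (M : NormedMod A) (n : ℕ) (x : M.X) :
    M.smul (SA.p n) (M.smul (SA.p n) x) = M.smul (SA.p n) x := by
  simp [SA.p_smul_smul, SA.coords_p]

lemma p_smul_p_smul_of_ne (M : NormedMod A) {m n : ℕ} (h : m ≠ n) (x : M.X) :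
    M.smul (SA.p m) (M.smul (SA.p n) x) = 0 := by
  simp [SA.p_smul_smul, SA.coords_p, h]

lemma norm_p_smul_le (M : NormedMod A) (n : ℕ) (x : M.X) : ‖M.smul (SA.p n) x‖ ≤ ‖x‖ := by
  simpa [SA.norm_p] using M.norm_smul_le (SA.p n) x

end SequenceAlgebra

lemma NormedMod.smul_zero (M : NormedMod A) (a : A) : M.smul a 0 = 0 :=
  map_zero (M.smulLM a)

variable {SA}

lemma p_smul_eq_self_of_mem_coordSub {M : NormedMod A} {n : ℕ} {x : M.X}
    (hx : x ∈ coordSub SA M n) : M.smul (SA.p n) x = x := by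
  obtain ⟨y, rfl⟩ := hx
  exact SA.p_smul_p_smul M n y

/-- In a homogeneous module an element is determined by its coordinates. -/
lemma Homogeneous.ext {M : NormedMod A} (hM : Homogeneous SA M) {x y : M.X}
    (h : ∀ n, M.smul (SA.p n) x = M.smul (SA.p n) y) : x = y := by
  have key : ‖x - y‖ ≤ ‖(0 : M.X)‖ := hM _ _ fun n => by
    have h1 : M.smul (SA.p n) (x - y) = 0 := by
      have := map_sub (M.smulLM (SA.p n)) x y
      rw [← sub_eq_zero.2 (h n)]
      exact this
    rw [h1, M.smul_zero]
  rw [norm_zero] at key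
  exact sub_eq_zero.1 (norm_le_zero_iff.1 key)

/-- An eventually zero sequence of coordinates is the coordinate sequence of an element. -/
lemma exists_of_coordinates (M : NormedMod A) (v : ℕ → M.X)
    (hv : ∀ n, M.smul (SA.p n) (v n) = v n) {N : ℕ} (hN : ∀ n, N ≤ n → v n = 0) :
    ∃ y : M.X, ∀ n, M.smul (SA.p n) y = v n := by
  refine ⟨∑ k ∈ Finset.range N, v k, fun n => ?_⟩
  have h1 : M.smul (SA.p n) (∑ k ∈ Finset.range N, v k)
      = ∑ k ∈ Finset.range N, M.smul (SA.p n) (v k) :=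
    map_sum (M.smulLM (SA.p n)) v (Finset.range N)
  rw [h1, Finset.sum_eq_single n, hv]
  · intro k _ hk
    rw [← hv k, SA.p_smul_p_smul_of_ne M hk.symm]
  · intro hn
    rw [hv, hN n (by simpa using hn)]

lemma norm_linearCombination_l1single {Λ : Type} (c : Λ →₀ ℂ) :
    ‖Finsupp.linearCombination ℂ (l1single Λ) c‖ = c.sum fun _ z => ‖z‖ := by
  classical
  have h := lp.norm_sum_single (E := fun _ : Λ => ℂ) (p := 1) (by simp) (fun l => c l) c.support
  simp only [ENNReal.toReal_one, Real.rpow_one] at h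
  rw [Finsupp.linearCombination_apply, Finsupp.sum, Finsupp.sum, ← h]
  congr 1
  refine Finset.sum_congr rfl fun l _ => ?_
  rw [l1single, ← lp.single_smul]
  simp only [smul_eq_mul, mul_one]

lemma linearIndependent_l1single (Λ : Type) : LinearIndependent ℂ (l1single Λ) := by
  rw [linearIndependent_iff]
  intro c hc
  have h := norm_linearCombination_l1single c
  rw [hc, norm_zero, Finsupp.sum, eq_comm, Finset.sum_eq_zero_iff_of_nonneg (by simp)] at h
  ext l
  by_contra hl
  exact hl (norm_eq_zero.1 (h l (Finsupp.mem_support_iff.2 hl)))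

/-- A space isometric to `l₁⁰(Λ)` has a basis with respect to which its norm is the `l₁`-norm. -/
lemma exists_basis_norm_eq_sum {E : Type} [NormedAddCommGroup E] [NormedSpace ℂ E] {Λ : Type}
    (e : E ≃ₗᵢ[ℂ] ↥(l10 Λ)) :
    ∃ b : Module.Basis Λ ℂ E, ∀ x, ‖x‖ = (b.repr x).sum fun _ z => ‖z‖ := by
  let b₀ : Module.Basis Λ ℂ ↥(l10 Λ) := Module.Basis.span (linearIndependent_l1single Λ)
  refine ⟨b₀.map e.symm.toLinearEquiv, fun x => ?_⟩
  have h1 : (b₀.map e.symm.toLinearEquiv).repr x = b₀.repr (e x) := rfl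
  rw [h1, ← norm_linearCombination_l1single, ← e.norm_map x]
  have h2 : (l10 Λ).subtype (Finsupp.linearCombination ℂ b₀ (b₀.repr (e x)))
      = Finsupp.linearCombination ℂ (l1single Λ) (b₀.repr (e x)) := by
    rw [Finsupp.apply_linearCombination]
    congr 2
    ext1 l
    exact congrArg Subtype.val (Module.Basis.span_apply (linearIndependent_l1single Λ) l)
  rw [← h2, b₀.linearCombination_repr]
  rfl

/-- On a space with an `l₁`-norm, a linear map determined on the basis by values dominated by
those of `f` is dominated at each `x` by the value of `f` at a point of the same norm. -/
lemma exists_norm_eq_norm_constr_le {E F G Λ : Type} [NormedAddCommGroup E] [NormedSpace ℂ E]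
    [NormedAddCommGroup F] [NormedSpace ℂ F] [NormedAddCommGroup G] [NormedSpace ℂ G]
    (b : Module.Basis Λ ℂ E) (hb : ∀ x, ‖x‖ = (b.repr x).sum fun _ z => ‖z‖)
    (f : E →ₗ[ℂ] F) (v : Λ → G) {C : ℝ} (hC : 0 ≤ C) (hv : ∀ l, ‖v l‖ ≤ C * ‖f (b l)‖) (x : E) :
    ∃ x' : E, ‖x'‖ = ‖x‖ ∧ ‖b.constr ℂ v x‖ ≤ C * ‖f x'‖ := by
  rcases (b.repr x).support.eq_empty_or_nonempty with h | h
  · have hx : x = 0 := by simpa using h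
    exact ⟨0, by simp [hx]⟩
  obtain ⟨l, -, hl⟩ := (b.repr x).support.exists_max_image (fun l => ‖f (b l)‖) h
  have hbl : ‖b l‖ = 1 := by simp [hb]
  refine ⟨(‖x‖ : ℂ) • b l, by simp [norm_smul, hbl], ?_⟩
  rw [b.constr_apply, map_smul, norm_smul, Complex.norm_real, norm_norm, hb x]
  calc ‖(b.repr x).sum fun k a => a • v k‖
      ≤ ∑ k ∈ (b.repr x).support, ‖b.repr x k • v k‖ := norm_sum_le _ _
    _ ≤ ∑ k ∈ (b.repr x).support, ‖b.repr x k‖ * (C * ‖f (b l)‖) := by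
        refine Finset.sum_le_sum fun k hk => ?_
        rw [norm_smul]
        have := hl k hk
        have := hv k
        gcongr
        exact this.trans (by gcongr)
    _ = C * (((b.repr x).sum fun _ z => ‖z‖) * ‖f (b l)‖) := by
        rw [← Finset.sum_mul, Finsupp.sum]
        ring

/-- Elements of a coordinate subspace lift along a coisometric morphism to elements of the same
coordinate subspace, with arbitrarily small relative increase of the norm. -/
lemma IsCoisometry.exists_lift_coordinate {MY MX : NormedMod A} {τ : MY.X →L[ℂ] MX.X}
    (hmor : IsMor MY MX τ) (hτ : IsCoisometry τ) {η : ℝ} (hη : 0 < η) {n : ℕ} {x : MX.X}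
    (hx : MX.smul (SA.p n) x = x) :
    ∃ y : MY.X, MY.smul (SA.p n) y = y ∧ τ y = x ∧ ‖y‖ ≤ (1 + η) * ‖x‖ := by
  by_cases h0 : x = 0
  · exact ⟨0, by simp [h0, MY.smul_zero]⟩
  obtain ⟨y, hy, hyn⟩ := hτ.2 x (η * ‖x‖) (mul_pos hη (norm_pos_iff.2 h0))
  refine ⟨MY.smul (SA.p n) y, SA.p_smul_p_smul MY n y, by rw [hmor, hy, hx], ?_⟩
  linarith [SA.norm_p_smul_le MY n y]

/-- The restriction of a morphism to a coordinate subspace of the form `l₁⁰(Λ)` lifts along a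
coisometric morphism. -/
lemma exists_lift_coordSub {P MY MX : NormedMod A} {τ : MY.X →L[ℂ] MX.X}
    (hmor : IsMor MY MX τ) (hτ : IsCoisometry τ) {φ : P.X →L[ℂ] MX.X} (hφ : IsMor P MX φ)
    {η : ℝ} (hη : 0 < η) {n : ℕ} {Λ : Type} (e : ↥(coordSub SA P n) ≃ₗᵢ[ℂ] ↥(l10 Λ)) :
    ∃ ψ : ↥(coordSub SA P n) →ₗ[ℂ] MY.X, ∀ x : ↥(coordSub SA P n),
      MY.smul (SA.p n) (ψ x) = ψ x ∧ τ (ψ x) = φ x ∧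
        ∃ x' : ↥(coordSub SA P n), ‖x'‖ = ‖x‖ ∧ ‖ψ x‖ ≤ (1 + η) * ‖φ x'‖ := by
  obtain ⟨b, hb⟩ := exists_basis_norm_eq_sum e
  have hfix (x : ↥(coordSub SA P n)) : MX.smul (SA.p n) (φ x) = φ x := by
    rw [← hφ, p_smul_eq_self_of_mem_coordSub x.2]
  choose v hv1 hv2 hv3 using fun l => hτ.exists_lift_coordinate hmor hη (hfix (b l))
  let f : ↥(coordSub SA P n) →ₗ[ℂ] MX.X := φ.toLinearMap ∘ₗ (coordSub SA P n).subtype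
  have h1 : MY.smulLM (SA.p n) ∘ₗ b.constr ℂ v = b.constr ℂ v :=
    b.ext fun l => by simpa [NormedMod.smulLM] using hv1 l
  have h2 : τ.toLinearMap ∘ₗ b.constr ℂ v = f := b.ext fun l => by simpa [f] using hv2 l
  exact ⟨b.constr ℂ v, fun x => ⟨LinearMap.congr_fun h1 x, LinearMap.congr_fun h2 x,
    exists_norm_eq_norm_constr_le b hb f v (by positivity) hv3 x⟩⟩

end Auxiliary

/-- Theorem 3.1: a homogeneous normed module `P` of finite type over a sequence algebra,
all whose coordinate subspaces are (isometrically) of the form `l₁⁰(Λₙ)`, is extremely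
projective with respect to the class `H` of essential homogeneous normed modules. -/
theorem homogeneous_finiteType_l10_extremelyProjective
    (P : NormedMod A) (hhom : Homogeneous SA P) (hft : FiniteType SA P)
    (hcoord : ∀ n : ℕ, ∃ Λ : Type, Nonempty (↥(coordSub SA P n) ≃ₗᵢ[ℂ] ↥(l10 Λ))) :
    ExtremelyProjective P (fun M => M.Essential ∧ Homogeneous SA M) := by
  rintro MY MX ⟨-, hYhom⟩ ⟨-, hXhom⟩ τ hmor hτ φ hφ ε hε
  obtain ⟨η, hη, hηε⟩ : ∃ η : ℝ, 0 < η ∧ (1 + η) * ‖φ‖ < ‖φ‖ + ε := by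
    refine ⟨ε / (‖φ‖ + 1), by positivity, ?_⟩
    have : ε / (‖φ‖ + 1) * ‖φ‖ < ε := by
      rw [div_mul_eq_mul_div, div_lt_iff₀ (by positivity)]
      nlinarith
    linarith
  choose Λ e using hcoord
  choose ψ hψ1 hψ2 x' hx'1 hx'2 using
    fun n => exists_lift_coordSub hmor hτ hφ hη (e n).some
  let q (n : ℕ) : P.X →ₗ[ℂ] ↥(coordSub SA P n) := (P.smulLM (SA.p n)).rangeRestrict
  have hq0 (x : P.X) : ∃ N, ∀ n, N ≤ n → q n x = 0 := by
    obtain ⟨N, hN⟩ := hft x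
    exact ⟨N, fun n hn => Subtype.ext (hN n hn)⟩
  have hex (x : P.X) : ∃ y : MY.X, ∀ n, MY.smul (SA.p n) y = ψ n (q n x) := by
    obtain ⟨N, hN⟩ := hq0 x
    exact exists_of_coordinates MY _ (fun n => hψ1 n _) (N := N) fun n hn => by
      rw [hN n hn, map_zero]
  choose g hg using hex
  let G : P.X →ₗ[ℂ] MY.X :=
    { toFun := g
      map_add' := fun x y => hYhom.ext fun n => by
        rw [MY.smul_add, hg, hg, hg, map_add, map_add]
      map_smul' := fun c x => hYhom.ext fun n => by
        rw [RingHom.id_apply, MY.smul_csmul, hg, hg, map_smul, map_smul] }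
  have hbound (x : P.X) : ‖G x‖ ≤ (1 + η) * ‖φ‖ * ‖x‖ := by
    obtain ⟨N, hN⟩ := hq0 x
    obtain ⟨w, hw⟩ := exists_of_coordinates (SA := SA) P (fun n => (x' n (q n x) : P.X))
      (fun n => p_smul_eq_self_of_mem_coordSub (x' n (q n x)).2) (N := N) fun n hn => by
        have := hx'1 n (q n x)
        rw [hN n hn, norm_zero, norm_eq_zero] at this
        simp [hN n hn, this]
    have hwx : ‖w‖ ≤ ‖x‖ := hhom _ _ fun n => by
      rw [hw]
      exact (hx'1 n (q n x)).le
    refine le_of_forall_pos_le_add fun δ hδ => ?_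
    obtain ⟨z, hz, hzn⟩ := hτ.2 (φ w) (δ / (1 + η)) (by positivity)
    have hGz : ‖G x‖ ≤ ‖((1 + η : ℝ) : ℂ) • z‖ := hYhom _ _ fun n => by
      rw [MY.smul_csmul, norm_smul, Complex.norm_real, Real.norm_of_nonneg (by positivity)]
      calc ‖MY.smul (SA.p n) (g x)‖ ≤ (1 + η) * ‖φ (x' n (q n x))‖ := by
            rw [hg]
            exact hx'2 n _
        _ = (1 + η) * ‖τ (MY.smul (SA.p n) z)‖ := by rw [hmor, hz, ← hφ, hw]
        _ ≤ (1 + η) * ‖MY.smul (SA.p n) z‖ := by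
            gcongr
            exact hτ.1 _
    rw [norm_smul, Complex.norm_real, Real.norm_of_nonneg (by positivity)] at hGz
    calc ‖G x‖ ≤ (1 + η) * ‖z‖ := hGz
      _ ≤ (1 + η) * (‖φ‖ * ‖x‖ + δ / (1 + η)) := by
          gcongr
          exact hzn.le.trans (by gcongr; exact (φ.le_opNorm w).trans (by gcongr))
      _ = (1 + η) * ‖φ‖ * ‖x‖ + δ := by
          field_simp
  refine ⟨G.mkContinuous _ hbound, fun a x => hYhom.ext fun n => ?_, ?_, ?_⟩
  · have hqa : q n (P.smul a x) = SA.coords a n • q n x :=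
      Subtype.ext (SA.p_smul_smul P n a x)
    change MY.smul (SA.p n) (g _) = MY.smul (SA.p n) (MY.smul a (g x))
    rw [SA.p_smul_smul, hg, hg, hqa, map_smul]
  · ext x
    refine hXhom.ext fun n => ?_
    change MX.smul (SA.p n) (τ (g x)) = _
    rw [← hmor, hg, hψ2, ← hφ]
    rfl
  · exact (G.mkContinuous_norm_le (by positivity) hbound).trans_lt hηε

end
end
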